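/- For every real number A there exist t₀ > 0 and a real analytic function f : ℝ → ℝ such that f(0) = 0, f'(0) = 1, (f'(t))² = 1 + A·f(t)² − f(t)⁴ for all t ∈ ℝ, f(t) > 0 for all t ∈ (0, 2t₀), f(2t₀) = 0, and f'(2t₀) = −1. -/

import Mathlib

open Set

open Filter

/-- A real function whose derivative extends holomorphically near `x` is analytic at `x`. -/
lemma analyticAt_of_hasDerivAt_re {G : ℂ → ℂ} {T : ℝ → ℝ} {x : ℝ} (hG : AnalyticAt ℂ G x)
    (hT : ∀ y : ℝ, HasDerivAt T (G y).re y) : AnalyticAt ℝ T x := by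
  obtain ⟨r, hr, hball⟩ := Metric.eventually_nhds_iff_ball.1 hG.eventually_analyticAt
  have hd : DifferentiableOn ℂ G (Metric.ball (x : ℂ) r) := fun z hz =>
    (hball z hz).differentiableAt.differentiableWithinAt
  obtain ⟨F, hF⟩ := hd.isExactOn_ball
  have hFan : AnalyticAt ℂ F x := by
    refine DifferentiableOn.analyticAt (s := Metric.ball (x : ℂ) r) (fun z hz => ?_)
      (Metric.ball_mem_nhds _ hr)
    exact (hF z hz).differentiableAt.differentiableWithinAt
  have hS : ∀ y ∈ Metric.ball x r, HasDerivAt (fun y : ℝ => (F y).re) (G y).re y := by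
    intro y hy
    refine (hF y ?_).real_of_complex
    simpa [Complex.dist_of_im_eq, Real.dist_eq] using hy
  have hconst : ∀ y ∈ Metric.ball x r, T y - (F y).re = T x - (F x).re := by
    intro y hy
    refine (convex_ball x r).is_const_of_fderivWithin_eq_zero (𝕜 := ℝ)
      (f := fun y : ℝ => T y - (F y).re) (fun z hz => ?_) (fun z hz => ?_) hy
      (Metric.mem_ball_self hr)
    · exact ((hT z).sub (hS z hz)).differentiableAt.differentiableWithinAt
    · rw [fderivWithin_of_isOpen Metric.isOpen_ball hz]
      have h := (hT z).sub (hS z hz)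
      rw [sub_self] at h
      exact h.hasFDerivAt.fderiv.trans (by simp)
  refine (hFan.re_ofReal.add (analyticAt_const (v := T x - (F x).re))).congr ?_
  filter_upwards [Metric.ball_mem_nhds x hr] with y hy
  simp [← hconst y hy]

/-- A function on `ℝ` whose derivative is bounded below by a positive constant is surjective. -/
lemma surjective_of_hasDerivAt_ge {T T' : ℝ → ℝ} {c : ℝ} (hc : 0 < c)
    (hT : ∀ x, HasDerivAt T (T' x) x) (hT' : ∀ x, c ≤ T' x) : Function.Surjective T := by
  have hmono : Monotone fun x => T x - c * x := by
    have h : ∀ x, HasDerivAt (fun x => T x - c * x) (T' x - c * 1) x := fun x =>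
      (hT x).sub ((hasDerivAt_id x).const_mul c)
    refine monotone_of_deriv_nonneg (fun x => (h x).differentiableAt) fun x => ?_
    rw [(h x).deriv]
    linarith [hT' x]
  have hcont : Continuous T := continuous_iff_continuousAt.2 fun x => (hT x).continuousAt
  refine hcont.surjective ?_ ?_
  · refine tendsto_atTop_mono' atTop (f₁ := fun x => T 0 + c * x) ?_
      (tendsto_atTop_add_const_left _ _ (tendsto_id.const_mul_atTop hc))
    filter_upwards [eventually_ge_atTop 0] with x hx
    have := hmono hx
    simp only [mul_zero, sub_zero] at this
    linarith
  · refine tendsto_atBot_mono' atBot (f₁ := fun x => T 0 + c * x) ?_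
      (tendsto_atBot_add_const_left _ _ (tendsto_id.const_mul_atBot hc))
    filter_upwards [eventually_le_atBot 0] with x hx
    have := hmono hx
    simp only [mul_zero, sub_zero] at this
    linarith

/-- The autonomous equation `θ' = √(b + P sin² θ)` has a global analytic increasing solution
which is onto. -/
lemma exists_analytic_angle {b P : ℝ} (hb : 0 < b) (hP : 0 ≤ P) :
    ∃ θ : ℝ → ℝ, (∀ t, AnalyticAt ℝ θ t) ∧ StrictMono θ ∧ Function.Surjective θ ∧ θ 0 = 0 ∧
      ∀ t, HasDerivAt θ √(b + P * Real.sin (θ t) ^ 2) t := by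
  set q : ℝ → ℝ := fun x => b + P * Real.sin x ^ 2 with hq
  have hqpos : ∀ x, 0 < q x := fun x => by positivity
  have hsq : ∀ x, 0 < √(q x) := fun x => Real.sqrt_pos.2 (hqpos x)
  have hqle : ∀ x, q x ≤ b + P := fun x => by
    have := mul_le_mul_of_nonneg_left (Real.sin_sq_le_one x) hP
    simp only [hq]
    linarith
  have hcont : Continuous fun x => (√(q x))⁻¹ :=
    (by fun_prop : Continuous fun x => √(q x)).inv₀ fun x => (hsq x).ne'
  set T : ℝ → ℝ := fun x => ∫ y in (0 : ℝ)..x, (√(q y))⁻¹ with hTdef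
  have hT : ∀ x, HasDerivAt T (√(q x))⁻¹ x := fun x =>
    (hcont.integral_hasStrictDerivAt 0 x).hasDerivAt
  have hTmono : StrictMono T := strictMono_of_deriv_pos fun x => by
    rw [(hT x).deriv]
    exact inv_pos.2 (hsq x)
  have hTsurj : Function.Surjective T :=
    surjective_of_hasDerivAt_ge (c := (√(b + P))⁻¹) (by positivity) hT fun x =>
      inv_anti₀ (hsq x) (Real.sqrt_le_sqrt (hqle x))
  have hTan : ∀ x, AnalyticAt ℝ T x := by
    intro x
    have hre : ∀ y : ℝ, (b : ℂ) + P * Complex.sin y ^ 2 = (q y : ℝ) := fun y => by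
      simp [hq]
    refine analyticAt_of_hasDerivAt_re
      (G := fun z => ((b : ℂ) + P * Complex.sin z ^ 2) ^ (-(1 / 2 : ℝ) : ℂ)) ?_ fun y => ?_
    · refine AnalyticAt.cpow ?_ analyticAt_const ?_
      · fun_prop
      · rw [hre]
        exact Complex.ofReal_mem_slitPlane.2 (hqpos x)
    · convert hT y using 1
      rw [hre, ← Complex.ofReal_neg, ← Complex.ofReal_cpow (hqpos y).le, Complex.ofReal_re,
        Real.rpow_neg (hqpos y).le, Real.sqrt_eq_rpow]
  let e : ℝ ≃o ℝ := hTmono.orderIsoOfSurjective T hTsurj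
  have heT : ∀ x, e.symm (T x) = x := fun x => e.symm_apply_apply x
  have hTe : ∀ t, T (e.symm t) = t := fun t => e.apply_symm_apply t
  have hT0 : T 0 = 0 := by simp [hTdef]
  refine ⟨e.symm, fun t => ?_, e.symm.strictMono, e.symm.surjective, ?_, fun t => ?_⟩
  · rw [← hTe t, ← analyticAt_comp_iff_of_deriv_ne_zero (hTan _)]
    · exact analyticAt_id.congr (Eventually.of_forall fun x => (heT x).symm)
    · rw [(hT _).deriv]
      exact (inv_pos.2 (hsq _)).ne'
  · simpa [hT0] using heT 0
  · have h := HasDerivAt.of_local_left_inverse e.symm.continuous.continuousAt (hT (e.symm t))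
      (inv_pos.2 (hsq _)).ne' (Eventually.of_forall hTe)
    simpa using h

/-- ODE core of Theorem 3, equation (2.7): for every `A` there is a global real
analytic solution of `(f')² = 1 + A f² - f⁴` with `f(0) = 0`, `f'(0) = 1`,
positive on `(0, 2t₀)`, and `f(2t₀) = 0`, `f'(2t₀) = -1`. -/
theorem stmt_13 (A : ℝ) :
    ∃ t₀ : ℝ, 0 < t₀ ∧ ∃ f : ℝ → ℝ,
      (∀ t : ℝ, AnalyticAt ℝ f t) ∧
      f 0 = 0 ∧ deriv f 0 = 1 ∧
      (∀ t : ℝ, (deriv f t) ^ 2 = 1 + A * (f t) ^ 2 - (f t) ^ 4) ∧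
      (∀ t ∈ Ioo (0 : ℝ) (2 * t₀), 0 < f t) ∧
      f (2 * t₀) = 0 ∧ deriv f (2 * t₀) = -1 := by
  obtain ⟨a, ha, hA⟩ : ∃ a : ℝ, 0 < a ∧ A = a ^ 2 - (a ^ 2)⁻¹ := by
    set P := (A + √(A ^ 2 + 4)) / 2 with hP
    have hs : √(A ^ 2 + 4) ^ 2 = A ^ 2 + 4 := Real.sq_sqrt (by positivity)
    have hPpos : 0 < P := by
      have : -A < √(A ^ 2 + 4) := Real.lt_sqrt_of_sq_lt (by linarith [neg_sq A])
      linarith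
    refine ⟨√P, Real.sqrt_pos.2 hPpos, ?_⟩
    rw [Real.sq_sqrt hPpos.le]
    field_simp
    rw [hP]
    linarith
  obtain ⟨θ, hθan, hθmono, hθsurj, hθ0, hθ'⟩ :=
    exists_analytic_angle (b := (a ^ 2)⁻¹) (P := a ^ 2) (by positivity) (by positivity)
  obtain ⟨s, hs⟩ := hθsurj Real.pi
  have hspos : 0 < s := hθmono.lt_iff_lt.1 (by rw [hθ0, hs]; exact Real.pi_pos)
  have hroot : √((a ^ 2)⁻¹) = a⁻¹ := by rw [Real.sqrt_inv, Real.sqrt_sq ha.le]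
  have hderiv : ∀ t, deriv (fun t => a * Real.sin (θ t)) t =
      a * (Real.cos (θ t) * √((a ^ 2)⁻¹ + a ^ 2 * Real.sin (θ t) ^ 2)) := fun t =>
    ((hθ' t).sin.const_mul a).deriv
  have h2 : 2 * (s / 2) = s := by ring
  refine ⟨s / 2, by positivity, fun t => a * Real.sin (θ t), fun t => ?_, ?_, ?_, fun t => ?_,
    fun t ht => ?_, ?_, ?_⟩
  · exact analyticAt_const.mul (Real.analyticAt_sin.comp (hθan t))
  · simp [hθ0]
  · rw [hderiv, hθ0]
    simp only [Real.cos_zero, Real.sin_zero, ne_eq, OfNat.ofNat_ne_zero, not_false_eq_true,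
      zero_pow, mul_zero, add_zero, hroot, one_mul]
    exact mul_inv_cancel₀ ha.ne'
  · rw [hderiv, mul_pow, mul_pow, Real.sq_sqrt (by positivity), Real.cos_sq', hA]
    field_simp
    ring
  · rw [h2] at ht
    refine mul_pos ha (Real.sin_pos_of_pos_of_lt_pi ?_ ?_)
    · simpa [hθ0] using hθmono ht.1
    · simpa [hs] using hθmono ht.2
  · simp [h2, hs]
  · rw [hderiv, h2, hs]
    simp only [Real.cos_pi, Real.sin_pi, ne_eq, OfNat.ofNat_ne_zero, not_false_eq_true,
      zero_pow, mul_zero, add_zero, hroot]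
    field_simp
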